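/- arXiv:math/0606471 — 6 statements merged into one kernel-verified Lean document; each statement's English description precedes it below -/
import Mathlib

section
/- If the payoff function f is convex on (0, ∞), then for every k with 0 ≤ k ≤ n the function s ↦ g_k(u,d,s) is convex on (0, ∞). -/
/-- The risk-neutral probability `p(u,d) = ((1+r) - d)/(u - d)`. -/
noncomputable def priceP (r u d : ℝ) : ℝ := ((1 + r) - d) / (u - d)

/-- The rational price
`g_k(u,d,s) = (1+r)^{-(n-k)} ∑_{j=0}^{n-k} C(n-k,j) p^j (1-p)^{n-k-j} f(s u^j d^{n-k-j})`. -/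
noncomputable def ratPrice (r : ℝ) (n : ℕ) (f : ℝ → ℝ) (u d : ℝ) (k : ℕ) (s : ℝ) : ℝ :=
  ((1 + r) ^ (n - k))⁻¹ *
    ∑ j ∈ Finset.range (n - k + 1),
      (Nat.choose (n - k) j : ℝ) * priceP r u d ^ j * (1 - priceP r u d) ^ (n - k - j) *
        f (s * u ^ j * d ^ (n - k - j))

/-- If `f` is convex on `(0,∞)`, then so is `s ↦ g_k(u,d,s)` for every `0 ≤ k ≤ n`. -/
theorem ratPrice_convexOn
    (r : ℝ) (hr : 0 ≤ r) (n : ℕ) (u d : ℝ)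
    (hd : 0 < d) (hdr : d < 1 + r) (hru : 1 + r < u) (f : ℝ → ℝ)
    (hf : ConvexOn ℝ (Set.Ioi (0 : ℝ)) f) :
    ∀ k : ℕ, k ≤ n → ConvexOn ℝ (Set.Ioi (0 : ℝ)) (fun s => ratPrice r n f u d k s) := by
  intro k _
  have hu : 0 < u := by linarith
  have hp : 0 ≤ priceP r u d := by
    unfold priceP
    exact div_nonneg (by linarith) (by linarith)
  have hq : 0 ≤ 1 - priceP r u d := by
    unfold priceP
    rw [sub_nonneg, div_le_one (by linarith)]
    linarith
  refine ⟨convex_Ioi 0, ?_⟩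
  intro x hx y hy a b ha hb hab
  have hx' : 0 < x := hx
  have hy' : 0 < y := hy
  simp only [ratPrice, smul_eq_mul]
  rw [mul_left_comm a, mul_left_comm b, ← mul_add, Finset.mul_sum _ _ a, Finset.mul_sum _ _ b,
    ← Finset.sum_add_distrib]
  refine mul_le_mul_of_nonneg_left (Finset.sum_le_sum fun j _ => ?_) (by positivity)
  have h := hf.2 (x := x * u ^ j * d ^ (n - k - j)) (y := y * u ^ j * d ^ (n - k - j))
    (by simp only [Set.mem_Ioi]; positivity) (by simp only [Set.mem_Ioi]; positivity) ha hb hab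
  simp only [smul_eq_mul] at h
  rw [mul_left_comm a, mul_left_comm b, ← mul_add]
  refine mul_le_mul_of_nonneg_left ?_ (by positivity)
  refine le_trans (le_of_eq ?_) h
  congr 1
  ring
end

section
/- Suppose f is convex on (0, ∞). For every k with 1 ≤ k ≤ n, every previous stock price s' > 0, and every jump value ξ with d ≤ ξ ≤ u, the local residual is nonnegative: δ_k(u,d) = ((u − ξ)/(u − d)) · g_k(u,d, s'·d) + ((ξ − d)/(u − d)) · g_k(u,d, s'·u) − g_k(u,d, s'·ξ) ≥ 0. -/
/-- If `f` is convex on `(0,∞)` and `d ≤ ξ ≤ u`, the local residual is nonnegative. -/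
theorem local_residual_nonneg
    (r : ℝ) (hr : 0 ≤ r) (n : ℕ) (u d : ℝ)
    (hd : 0 < d) (hdr : d < 1 + r) (hru : 1 + r < u) (f : ℝ → ℝ)
    (hf : ConvexOn ℝ (Set.Ioi (0 : ℝ)) f) :
    ∀ k : ℕ, 1 ≤ k → k ≤ n → ∀ s' : ℝ, 0 < s' → ∀ ξ : ℝ, d ≤ ξ → ξ ≤ u →
      0 ≤ ((u - ξ) / (u - d)) * ratPrice r n f u d k (s' * d) +
            ((ξ - d) / (u - d)) * ratPrice r n f u d k (s' * u) -
            ratPrice r n f u d k (s' * ξ) := by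
  intro k _ _ s' hs ξ h1 h2
  have hud : 0 < u - d := by linarith
  have hu : 0 < u := by linarith
  have hξ : 0 < ξ := by linarith
  have hp0 : 0 ≤ priceP r u d := div_nonneg (by linarith) hud.le
  have hp1 : 0 ≤ 1 - priceP r u d := by
    have : priceP r u d ≤ 1 := by
      unfold priceP
      rw [div_le_one hud]
      linarith
    linarith
  set a := (u - ξ) / (u - d) with ha
  set b := (ξ - d) / (u - d) with hb
  have ha0 : 0 ≤ a := div_nonneg (by linarith) hud.le
  have hb0 : 0 ≤ b := div_nonneg (by linarith) hud.le
  have hab : a + b = 1 := by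
    rw [ha, hb]
    field_simp
    ring
  have habξ : a * d + b * u = ξ := by
    rw [ha, hb]
    field_simp
    ring
  rw [sub_nonneg]
  unfold ratPrice
  rw [mul_left_comm a, mul_left_comm b, ← mul_add, Finset.mul_sum _ _ a, Finset.mul_sum _ _ b,
    ← Finset.sum_add_distrib]
  refine mul_le_mul_of_nonneg_left (Finset.sum_le_sum fun j _ => ?_) (by positivity)
  have key := hf.2 (x := s' * d * u ^ j * d ^ (n - k - j))
    (y := s' * u * u ^ j * d ^ (n - k - j))
    (Set.mem_Ioi.2 (by positivity)) (Set.mem_Ioi.2 (by positivity)) ha0 hb0 hab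
  simp only [smul_eq_mul] at key
  have e : a * (s' * d * u ^ j * d ^ (n - k - j)) + b * (s' * u * u ^ j * d ^ (n - k - j))
      = s' * ξ * u ^ j * d ^ (n - k - j) := by
    rw [← habξ]
    ring
  rw [e] at key
  have hc : 0 ≤ (Nat.choose (n - k) j : ℝ) * priceP r u d ^ j *
      (1 - priceP r u d) ^ (n - k - j) := by positivity
  calc _ ≤ _ := mul_le_mul_of_nonneg_left key hc
    _ = _ := by ring
end

section
/- Suppose f is convex on (0, ∞). For every k with 1 ≤ k ≤ n, every previous stock price s' > 0, and every jump value ξ > 0 lying outside the interval [d, u] (i.e. 0 < ξ < d or ξ > u), the local residual is nonpositive: δ_k(u,d) = ((u − ξ)/(u − d)) · g_k(u,d, s'·d) + ((ξ − d)/(u − d)) · g_k(u,d, s'·u) − g_k(u,d, s'·ξ) ≤ 0. -/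
theorem three_point_aux (f : ℝ → ℝ) (hf : ConvexOn ℝ (Set.Ioi (0 : ℝ)) f)
    (c x y z : ℝ) (hc : 0 < c) (hx : 0 < x) (hxy : x < y) (hyz : y < z) :
    (z - x) * f (c * y) ≤ (z - y) * f (c * x) + (y - x) * f (c * z) := by
  have hzx : 0 < z - x := by linarith
  have hcx : c * x ∈ Set.Ioi (0 : ℝ) := mul_pos hc hx
  have hcz : c * z ∈ Set.Ioi (0 : ℝ) := mul_pos hc (by linarith)
  have ha : 0 ≤ (z - y) / (z - x) := div_nonneg (by linarith) hzx.le
  have hb : 0 ≤ (y - x) / (z - x) := div_nonneg (by linarith) hzx.le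
  have hab : (z - y) / (z - x) + (y - x) / (z - x) = 1 := by
    field_simp; ring
  have h := hf.2 hcx hcz ha hb hab
  simp only [smul_eq_mul] at h
  have e : (z - y) / (z - x) * (c * x) + (y - x) / (z - x) * (c * z) = c * y := by
    field_simp; ring
  rw [e] at h
  have h2 := mul_le_mul_of_nonneg_left h hzx.le
  refine h2.trans (le_of_eq ?_)
  field_simp

/-- If `f` is convex on `(0,∞)` and the jump `ξ > 0` lies outside `[d,u]`,
the local residual is nonpositive. -/
theorem local_residual_nonpos
    (r : ℝ) (hr : 0 ≤ r) (n : ℕ) (u d : ℝ)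
    (hd : 0 < d) (hdr : d < 1 + r) (hru : 1 + r < u) (f : ℝ → ℝ)
    (hf : ConvexOn ℝ (Set.Ioi (0 : ℝ)) f) :
    ∀ k : ℕ, 1 ≤ k → k ≤ n → ∀ s' : ℝ, 0 < s' → ∀ ξ : ℝ, 0 < ξ →
      (ξ < d ∨ u < ξ) →
      ((u - ξ) / (u - d)) * ratPrice r n f u d k (s' * d) +
          ((ξ - d) / (u - d)) * ratPrice r n f u d k (s' * u) -
          ratPrice r n f u d k (s' * ξ) ≤ 0 := by
  intro k _ _ s' hs ξ hξ hout
  have hud : 0 < u - d := by linarith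
  have hu : 0 < u := by linarith
  have hp0 : 0 ≤ priceP r u d := div_nonneg (by linarith) hud.le
  have hp1 : 0 ≤ 1 - priceP r u d := by
    unfold priceP
    rw [sub_nonneg, div_le_one hud]
    linarith
  have key : ∀ c : ℝ, 0 < c →
      ((u - ξ) / (u - d)) * f (c * d) + ((ξ - d) / (u - d)) * f (c * u) - f (c * ξ) ≤ 0 := by
    intro c hc
    have e : ((u - ξ) / (u - d)) * f (c * d) + ((ξ - d) / (u - d)) * f (c * u) - f (c * ξ)
        = ((u - ξ) * f (c * d) + (ξ - d) * f (c * u) - (u - d) * f (c * ξ)) / (u - d) := by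
      field_simp
    rw [e]
    apply div_nonpos_of_nonpos_of_nonneg _ hud.le
    rcases hout with h | h
    · have := three_point_aux f hf c ξ d u hc hξ h (by linarith)
      linarith
    · have := three_point_aux f hf c d u ξ hc hd (by linarith) h
      linarith
  unfold ratPrice
  have hr1 : 0 ≤ ((1 + r) ^ (n - k))⁻¹ := by positivity
  have e : ∀ A B R X Y Z : ℝ, A * (R * X) + B * (R * Y) - R * Z = R * (A * X + B * Y - Z) := by
    intros; ring
  rw [e]
  apply mul_nonpos_of_nonneg_of_nonpos hr1
  rw [Finset.mul_sum, Finset.mul_sum, ← Finset.sum_add_distrib, ← Finset.sum_sub_distrib]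
  apply Finset.sum_nonpos
  intro j _
  have hw : 0 ≤ (Nat.choose (n - k) j : ℝ) * priceP r u d ^ j *
      (1 - priceP r u d) ^ (n - k - j) := by positivity
  have hk := key (s' * u ^ j * d ^ (n - k - j)) (by positivity)
  have e2 : ∀ x : ℝ, s' * x * u ^ j * d ^ (n - k - j) = s' * u ^ j * d ^ (n - k - j) * x := by
    intro x; ring
  rw [e2, e2, e2, e]
  exact mul_nonpos_of_nonneg_of_nonpos hw hk
end

section
/- Suppose f is convex on (0, ∞). Then for every k with 0 ≤ k ≤ n and every s > 0, the rational price dominates the discounted payoff of the risk-neutral forward value: g_k(u,d,s) ≥ (1+r)^{-(n−k)} · f(s · (1+r)^{n−k}). In particular, for the European call payoff f(s) = max(s − K, 0) with strike K > 0, one has g_k(u,d,s) ≥ (1+r)^{-(n−k)} · max(s (1+r)^{n−k} − K, 0), i.e. the rational price is at least the lower no-arbitrage bound x̲_k. -/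
/-- The rational price dominates the discounted payoff of the risk-neutral forward
value; in particular, for a European call it is at least the lower no-arbitrage
bound. -/
theorem ratPrice_ge_lower_bound
    (r : ℝ) (hr : 0 ≤ r) (n : ℕ) (u d : ℝ)
    (hd : 0 < d) (hdr : d < 1 + r) (hru : 1 + r < u) :
    (∀ f : ℝ → ℝ, ConvexOn ℝ (Set.Ioi (0 : ℝ)) f →
      ∀ k : ℕ, k ≤ n → ∀ s : ℝ, 0 < s →
        ((1 + r) ^ (n - k))⁻¹ * f (s * (1 + r) ^ (n - k)) ≤ ratPrice r n f u d k s) ∧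
    (∀ K : ℝ, 0 < K → ∀ k : ℕ, k ≤ n → ∀ s : ℝ, 0 < s →
      ((1 + r) ^ (n - k))⁻¹ * max (s * (1 + r) ^ (n - k) - K) 0 ≤
        ratPrice r n (fun x => max (x - K) 0) u d k s) := by
  have hud : 0 < u - d := by linarith
  have hp0 : 0 ≤ priceP r u d := div_nonneg (by linarith) hud.le
  have hp1 : 0 ≤ 1 - priceP r u d := by
    have : priceP r u d ≤ 1 := by
      unfold priceP
      rw [div_le_one hud]
      linarith
    linarith
  have hpm : priceP r u d * u + (1 - priceP r u d) * d = 1 + r := by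
    unfold priceP
    field_simp
    ring
  have hu : 0 < u := by linarith
  have main : ∀ f : ℝ → ℝ, ConvexOn ℝ (Set.Ioi (0 : ℝ)) f →
      ∀ k : ℕ, k ≤ n → ∀ s : ℝ, 0 < s →
        ((1 + r) ^ (n - k))⁻¹ * f (s * (1 + r) ^ (n - k)) ≤ ratPrice r n f u d k s := by
    intro f hf k _ s hs
    unfold ratPrice
    refine mul_le_mul_of_nonneg_left ?_ (by positivity)
    generalize n - k = m
    generalize priceP r u d = p at *
    have h1 : ∑ j ∈ Finset.range (m + 1),
        (Nat.choose m j : ℝ) * p ^ j * (1 - p) ^ (m - j) = 1 := by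
      have h := add_pow p (1 - p) m
      rw [add_sub_cancel, one_pow] at h
      refine Eq.trans ?_ h.symm
      exact Finset.sum_congr rfl fun j _ => by ring
    have h2 : ∑ j ∈ Finset.range (m + 1),
        ((Nat.choose m j : ℝ) * p ^ j * (1 - p) ^ (m - j)) • (s * u ^ j * d ^ (m - j))
          = s * (1 + r) ^ m := by
      rw [← hpm, add_pow, Finset.mul_sum]
      refine Finset.sum_congr rfl fun j _ => ?_
      rw [smul_eq_mul, mul_pow, mul_pow]
      ring
    have h3 := hf.map_sum_le (t := Finset.range (m + 1))
      (w := fun j => (Nat.choose m j : ℝ) * p ^ j * (1 - p) ^ (m - j))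
      (p := fun j => s * u ^ j * d ^ (m - j))
      (fun j _ => by positivity) h1
      (fun j _ => by
        show 0 < s * u ^ j * d ^ (m - j)
        positivity)
    rw [h2] at h3
    simpa only [smul_eq_mul] using h3
  refine ⟨main, fun K _ k hk s hs => ?_⟩
  refine main (fun x => max (x - K) 0) ?_ k hk s hs
  have hc : ConvexOn ℝ (Set.Ioi (0 : ℝ)) (fun x : ℝ => x - K) :=
    (convexOn_id (convex_Ioi 0)).sub (concaveOn_const K (convex_Ioi 0))
  exact hc.sup (convexOn_const 0 (convex_Ioi 0))
end

section
/- Suppose f is convex on (0, ∞), and let D, U, d, u be real parameters with 0 < D ≤ d < 1 + r < u ≤ U. Then for every k with 0 ≤ k ≤ n and every s > 0, shrinking the jump interval lowers the price: g_k(u,d,s) ≤ g_k(U,D,s). -/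
/-- Undiscounted expectation. -/
noncomputable def binE (p q u d : ℝ) (f : ℝ → ℝ) (m : ℕ) (s : ℝ) : ℝ :=
  ∑ j ∈ Finset.range (m + 1),
      (Nat.choose m j : ℝ) * p ^ j * q ^ (m - j) * f (s * u ^ j * d ^ (m - j))

lemma binE_anti (p q u d : ℝ) (f : ℝ → ℝ) (m : ℕ) (s : ℝ) :
    binE p q u d f m s = ∑ ij ∈ Finset.HasAntidiagonal.antidiagonal m,
      (Nat.choose m ij.1 : ℝ) * (p ^ ij.1 * q ^ ij.2 * f (s * u ^ ij.1 * d ^ ij.2)) := by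
  rw [Finset.Nat.sum_antidiagonal_eq_sum_range_succ
    (fun i j => (Nat.choose m i : ℝ) * (p ^ i * q ^ j * f (s * u ^ i * d ^ j)))]
  unfold binE
  apply Finset.sum_congr rfl
  intro j _
  ring

lemma binE_succ (p q u d : ℝ) (f : ℝ → ℝ) (m : ℕ) (s : ℝ) :
    binE p q u d f (m + 1) s =
      p * binE p q u d f m (s * u) + q * binE p q u d f m (s * d) := by
  simp only [binE_anti]
  rw [Finset.sum_antidiagonal_choose_succ_mul
    (fun i j => (p ^ i * q ^ j * f (s * u ^ i * d ^ j))), add_comm, Finset.mul_sum,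
    Finset.mul_sum]
  congr 1
  · apply Finset.sum_congr rfl
    intro ij h
    have h' : m = ij.1 + ij.2 := (Finset.HasAntidiagonal.mem_antidiagonal.mp h).symm
    rw [← Nat.choose_symm_of_eq_add h',
      show s * u ^ (ij.1 + 1) * d ^ ij.2 = s * u * u ^ ij.1 * d ^ ij.2 by ring]
    ring
  · apply Finset.sum_congr rfl
    intro ij _
    rw [show s * u ^ ij.1 * d ^ (ij.2 + 1) = s * d * u ^ ij.1 * d ^ ij.2 by ring]
    ring

lemma convexOn_scale {h : ℝ → ℝ} (hh : ConvexOn ℝ (Set.Ioi (0 : ℝ)) h) {c : ℝ} (hc : 0 < c) :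
    ConvexOn ℝ (Set.Ioi (0 : ℝ)) (fun s => h (s * c)) := by
  refine ⟨convex_Ioi 0, fun x hx y hy a b ha hb hab => ?_⟩
  have := hh.2 (x := x * c) (y := y * c) (mul_pos hx hc) (mul_pos hy hc) ha hb hab
  simp only [smul_eq_mul] at this ⊢
  rwa [show (a * x + b * y) * c = a * (x * c) + b * (y * c) by ring]

lemma binE_convex {p q u d : ℝ} (hp : 0 ≤ p) (hq : 0 ≤ q) (hu : 0 < u) (hd : 0 < d)
    {f : ℝ → ℝ} (hf : ConvexOn ℝ (Set.Ioi (0 : ℝ)) f) (m : ℕ) :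
    ConvexOn ℝ (Set.Ioi (0 : ℝ)) (binE p q u d f m) := by
  induction m with
  | zero =>
    have : binE p q u d f 0 = f := by funext s; simp [binE]
    rwa [this]
  | succ m ih =>
    have : binE p q u d f (m + 1) = (fun s => p • binE p q u d f m (s * u)) +
        (fun s => q • binE p q u d f m (s * d)) := by
      funext s; simp [binE_succ]
    rw [this]
    exact ((convexOn_scale ih hu).smul hp).add ((convexOn_scale ih hd).smul hq)

lemma one_step {r U D u d : ℝ}
    (hD : 0 < D) (hDd : D ≤ d) (hdr : d < 1 + r) (hru : 1 + r < u) (huU : u ≤ U)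
    {h : ℝ → ℝ} (hh : ConvexOn ℝ (Set.Ioi (0 : ℝ)) h) {s : ℝ} (hs : 0 < s) :
    priceP r u d * h (s * u) + (1 - priceP r u d) * h (s * d) ≤
      priceP r U D * h (s * U) + (1 - priceP r U D) * h (s * D) := by
  have hUD : 0 < U - D := by linarith
  have hud : 0 < u - d := by linarith
  have key : ∀ x, D ≤ x → x ≤ U →
      h (s * x) ≤ (x - D) / (U - D) * h (s * U) + (U - x) / (U - D) * h (s * D) := by
    intro x h1 h2
    have hU0 : s * U ∈ Set.Ioi (0 : ℝ) := mul_pos hs (by linarith)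
    have hD0 : s * D ∈ Set.Ioi (0 : ℝ) := mul_pos hs hD
    have ha : 0 ≤ (x - D) / (U - D) := div_nonneg (by linarith) hUD.le
    have hb : 0 ≤ (U - x) / (U - D) := div_nonneg (by linarith) hUD.le
    have hab : (x - D) / (U - D) + (U - x) / (U - D) = 1 := by
      field_simp
      ring
    have := hh.2 hU0 hD0 ha hb hab
    simp only [smul_eq_mul] at this
    rwa [show (x - D) / (U - D) * (s * U) + (U - x) / (U - D) * (s * D) = s * x by
      field_simp; ring] at this
  have hp : 0 ≤ priceP r u d := div_nonneg (by linarith) hud.le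
  have hq : 0 ≤ 1 - priceP r u d := by
    unfold priceP
    rw [sub_nonneg, div_le_one hud]; linarith
  have e1 := mul_le_mul_of_nonneg_left (key u (by linarith) huU) hp
  have e2 := mul_le_mul_of_nonneg_left (key d hDd (by linarith)) hq
  refine (add_le_add e1 e2).trans (le_of_eq ?_)
  unfold priceP
  field_simp
  ring

lemma binE_mono {r U D u d : ℝ}
    (hD : 0 < D) (hDd : D ≤ d) (hdr : d < 1 + r) (hru : 1 + r < u) (huU : u ≤ U)
    {f : ℝ → ℝ} (hf : ConvexOn ℝ (Set.Ioi (0 : ℝ)) f) (m : ℕ) : ∀ s : ℝ, 0 < s →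
    binE (priceP r u d) (1 - priceP r u d) u d f m s ≤
      binE (priceP r U D) (1 - priceP r U D) U D f m s := by
  have hpq : ∀ u d : ℝ, d < 1 + r → 1 + r < u →
      0 ≤ priceP r u d ∧ 0 ≤ 1 - priceP r u d := by
    intro u d h1 h2
    have hud : 0 < u - d := by linarith
    refine ⟨div_nonneg (by linarith) hud.le, ?_⟩
    unfold priceP
    rw [sub_nonneg, div_le_one hud]; linarith
  obtain ⟨hp, hq⟩ := hpq u d hdr hru
  obtain ⟨hP, hQ⟩ := hpq U D (by linarith) (by linarith)
  induction m with
  | zero => intro s _; simp [binE]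
  | succ m ih =>
    intro s hs
    rw [binE_succ, binE_succ]
    refine le_trans (add_le_add
      (mul_le_mul_of_nonneg_left (ih (s * u) (mul_pos hs (by linarith))) hp)
      (mul_le_mul_of_nonneg_left (ih (s * d) (mul_pos hs (by linarith))) hq)) ?_
    exact one_step hD hDd hdr hru huU
      (binE_convex hP hQ (by linarith) hD hf m) hs

/-- Shrinking the jump interval lowers the rational price of a convex payoff. -/
theorem ratPrice_mono_interval
    (r : ℝ) (hr : 0 ≤ r) (n : ℕ) (U D u d : ℝ)
    (hD : 0 < D) (hDd : D ≤ d) (hdr : d < 1 + r) (hru : 1 + r < u) (huU : u ≤ U)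
    (f : ℝ → ℝ) (hf : ConvexOn ℝ (Set.Ioi (0 : ℝ)) f) :
    ∀ k : ℕ, k ≤ n → ∀ s : ℝ, 0 < s →
      ratPrice r n f u d k s ≤ ratPrice r n f U D k s := by
  intro k _ s hs
  unfold ratPrice
  exact mul_le_mul_of_nonneg_left (binE_mono hD hDd hdr hru huU hf (n - k) s hs)
    (inv_nonneg.mpr (pow_nonneg (by linarith) _))
end

section
/- Suppose f is convex on (0, ∞). Let s_0 > 0 and let ξ_1, …, ξ_n be jump values with d ≤ ξ_k ≤ u for every k, and set s_k = s_0 · ξ_1 ⋯ ξ_k. Then the accumulated residual Δ_n(u,d) = Σ_{k=1}^{n} δ_k(u,d) · (1+r)^{n−k} is nonnegative, where δ_k(u,d) = ((u − ξ_k)/(u − d)) · g_k(u,d, s_{k−1} d) + ((ξ_k − d)/(u − d)) · g_k(u,d, s_{k−1} u) − g_k(u,d, s_{k−1} ξ_k). -/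
theorem ratPrice_convex_aux (r : ℝ) (hr : 0 ≤ r) (n : ℕ) (u d : ℝ)
    (hd : 0 < d) (hdr : d < 1 + r) (hru : 1 + r < u) (f : ℝ → ℝ)
    (hf : ConvexOn ℝ (Set.Ioi (0 : ℝ)) f) (k : ℕ) (x y a b : ℝ) (hx : 0 < x) (hy : 0 < y)
    (ha : 0 ≤ a) (hb : 0 ≤ b) (hab : a + b = 1) :
    ratPrice r n f u d k (a * x + b * y) ≤
      a * ratPrice r n f u d k x + b * ratPrice r n f u d k y := by
  have hp0 : 0 ≤ priceP r u d := div_nonneg (by linarith) (by linarith)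
  have hp1 : 0 ≤ 1 - priceP r u d := by
    have : priceP r u d ≤ 1 := (div_le_one (by linarith)).2 (by linarith)
    linarith
  have hu : 0 < u := by linarith
  unfold ratPrice
  have e : ∀ c A B : ℝ, a * (c * A) + b * (c * B) = c * (a * A + b * B) := by
    intros; ring
  rw [e]
  refine mul_le_mul_of_nonneg_left ?_ (by positivity)
  rw [Finset.mul_sum, Finset.mul_sum, ← Finset.sum_add_distrib]
  refine Finset.sum_le_sum fun j _ => ?_
  rw [e]
  refine mul_le_mul_of_nonneg_left ?_ (by positivity)
  have h := hf.2 (x := x * u ^ j * d ^ (n - k - j)) (y := y * u ^ j * d ^ (n - k - j))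
    (Set.mem_Ioi.2 (by positivity)) (Set.mem_Ioi.2 (by positivity)) ha hb hab
  simp only [smul_eq_mul] at h
  convert h using 2
  ring

/-- If all jumps lie in `[d,u]` and `f` is convex on `(0,∞)`, the accumulated
residual `Δ_n(u,d) = ∑_{k=1}^n δ_k(u,d) (1+r)^{n-k}` is nonnegative. -/
theorem accumulated_residual_nonneg
    (r : ℝ) (hr : 0 ≤ r) (n : ℕ) (u d : ℝ)
    (hd : 0 < d) (hdr : d < 1 + r) (hru : 1 + r < u) (f : ℝ → ℝ)
    (hf : ConvexOn ℝ (Set.Ioi (0 : ℝ)) f)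
    (s0 : ℝ) (hs0 : 0 < s0) (ξ : ℕ → ℝ)
    (hξ : ∀ k : ℕ, 1 ≤ k → k ≤ n → d ≤ ξ k ∧ ξ k ≤ u)
    (s : ℕ → ℝ) (hs : ∀ k : ℕ, s k = s0 * ∏ i ∈ Finset.Icc 1 k, ξ i) :
    0 ≤ ∑ k ∈ Finset.Icc 1 n,
        (((u - ξ k) / (u - d)) * ratPrice r n f u d k (s (k - 1) * d) +
            ((ξ k - d) / (u - d)) * ratPrice r n f u d k (s (k - 1) * u) -
            ratPrice r n f u d k (s (k - 1) * ξ k)) * (1 + r) ^ (n - k) := by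
  have hud : 0 < u - d := by linarith
  refine Finset.sum_nonneg fun k hk => mul_nonneg ?_ (by positivity)
  obtain ⟨hk1, hkn⟩ := Finset.mem_Icc.1 hk
  obtain ⟨h1, h2⟩ := hξ k hk1 hkn
  have hsp : 0 < s (k - 1) := by
    rw [hs]
    refine mul_pos hs0 (Finset.prod_pos fun i hi => ?_)
    obtain ⟨hi1, hi2⟩ := Finset.mem_Icc.1 hi
    exact lt_of_lt_of_le hd (hξ i hi1 (by omega)).1
  have hu : 0 < u := by linarith
  have h := ratPrice_convex_aux r hr n u d hd hdr hru f hf k (s (k - 1) * d) (s (k - 1) * u)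
    ((u - ξ k) / (u - d)) ((ξ k - d) / (u - d)) (by positivity) (by positivity)
    (div_nonneg (by linarith) hud.le) (div_nonneg (by linarith) hud.le)
    (by field_simp; ring)
  have e : (u - ξ k) / (u - d) * (s (k - 1) * d) + (ξ k - d) / (u - d) * (s (k - 1) * u)
      = s (k - 1) * ξ k := by
    field_simp
    ring
  rw [e] at h
  linarith
end
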